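/- (Unique continuation.) Let i = 1 or i = 2, let 0 < ε ≤ ∞, and let D be the time-dependent operator Dξ = ∂_sξ + J₀∂_tξ + S(s,t)ξ on [0,ε)×[0,1]; in the case ε = ∞ assume hypothesis (H1). Then the map ξ ↦ (Dξ, ξ(0,·)) defined on H^i_{bc}([0,ε)×[0,1]) is injective; in particular any ξ with Dξ = 0 and ξ(0,·) = 0 vanishes identically. The analogous statement holds for the formal adjoint D*ξ = −∂_sξ + J₀∂_tξ + S(s,t)^Tξ: the map ξ ↦ (D*ξ, ξ(0,·)) is injective. -/

import Mathlib

open scoped RealInnerProductSpace Classical ENNReal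
open MeasureTheory Set

noncomputable section

variable {E : Type*} [NormedAddCommGroup E] [InnerProductSpace ℝ E]

/-- The domain `[0,ε) × [0,1] ⊆ ℝ²` (with `0 < ε ≤ ∞`). -/
def Corner (ε : ℝ≥0∞) : Set (ℝ × ℝ) :=
  {p : ℝ × ℝ | 0 ≤ p.1 ∧ ENNReal.ofReal p.1 < ε ∧ p.2 ∈ Icc (0:ℝ) 1}

/-- Membership in `H¹_bc([0,ε)×[0,1])` (strong representative with derivative data). -/
def H1bcOn (Λ : Submodule ℝ E) (ε : ℝ≥0∞) (u : ℝ × ℝ → E)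
    (Du : ℝ × ℝ → ℝ × ℝ →L[ℝ] E) : Prop :=
  (∀ p ∈ Corner ε, HasFDerivWithinAt u (Du p) (Corner ε) p) ∧
  IntegrableOn (fun p => ‖u p‖ ^ 2) (Corner ε) volume ∧
  IntegrableOn (fun p => ‖Du p (1, 0)‖ ^ 2) (Corner ε) volume ∧
  IntegrableOn (fun p => ‖Du p (0, 1)‖ ^ 2) (Corner ε) volume ∧
  (∀ s : ℝ, 0 ≤ s → ENNReal.ofReal s < ε → u (s, 0) ∈ Λ ∧ u (s, 1) ∈ Λ)

/-- Membership in `H²_bc([0,ε)×[0,1])` (strong representative; the boundary conditions are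
`u(s,i) ∈ Λ` and `Au(s,i) ∈ Λ` for `A = J∂_t + S₁(t)`). -/
def H2bcOn (Λ : Submodule ℝ E) (J : E →L[ℝ] E) (S1 : ℝ → E →L[ℝ] E) (ε : ℝ≥0∞)
    (u : ℝ × ℝ → E) (Du : ℝ × ℝ → ℝ × ℝ →L[ℝ] E)
    (D2u : ℝ × ℝ → ℝ × ℝ →L[ℝ] ℝ × ℝ →L[ℝ] E) : Prop :=
  H1bcOn Λ ε u Du ∧
  (∀ p ∈ Corner ε, HasFDerivWithinAt Du (D2u p) (Corner ε) p) ∧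
  IntegrableOn (fun p => ‖D2u p (1, 0) (1, 0)‖ ^ 2) (Corner ε) volume ∧
  IntegrableOn (fun p => ‖D2u p (1, 0) (0, 1)‖ ^ 2) (Corner ε) volume ∧
  IntegrableOn (fun p => ‖D2u p (0, 1) (0, 1)‖ ^ 2) (Corner ε) volume ∧
  (∀ s : ℝ, 0 ≤ s → ENNReal.ofReal s < ε →
    J (Du (s, 0) (0, 1)) + S1 0 (u (s, 0)) ∈ Λ ∧
    J (Du (s, 1) (0, 1)) + S1 1 (u (s, 1)) ∈ Λ)

/-- Hypothesis (HA) for `A = J∂_t + S₁(t)`, encoded through a complete orthonormal family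
of eigenfunctions with nonzero eigenvalues. -/
def EigenData (J : E →L[ℝ] E) (Λ : Submodule ℝ E) (S1 : ℝ → E →L[ℝ] E)
    {ι : Type*} (x : ι → ℝ → E) (μ : ι → ℝ) : Prop :=
  (∀ i, ContDiff ℝ (⊤ : ℕ∞) (x i)) ∧
  (∀ i, μ i ≠ 0) ∧
  (∀ i, x i 0 ∈ Λ ∧ x i 1 ∈ Λ) ∧
  (∀ i t, J (deriv (x i) t) + S1 t (x i t) = μ i • x i t) ∧
  (∀ i j, (∫ t in (0:ℝ)..1, ⟪x i t, x j t⟫) = if i = j then 1 else 0) ∧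
  (∀ y : ℝ → E, ContinuousOn y (Icc 0 1) →
    (∀ i, (∫ t in (0:ℝ)..1, ⟪y t, x i t⟫) = 0) → ∀ t ∈ Icc 0 1, y t = 0)

section UniqueContinuation

open Filter Topology

/-- Young's inequality for the average of `p` over a moving window of length `2h`. -/
theorem lintegral_window_sq_le {p : ℝ → ℝ≥0∞} (hp : Measurable p) (h : ℝ) :
    ∫⁻ s, (∫⁻ σ in Ioc (-h) h, p (s + σ)) ^ 2 ≤ ENNReal.ofReal (2 * h) ^ 2 * ∫⁻ s, p s ^ 2 := by
  have hvol : (volume (Ioc (-h) h)) = ENNReal.ofReal (2 * h) := by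
    rw [Real.volume_Ioc]; congr 1; ring
  have hcs : ∀ s, (∫⁻ σ in Ioc (-h) h, p (s + σ)) ^ 2
      ≤ ENNReal.ofReal (2 * h) * ∫⁻ σ in Ioc (-h) h, p (s + σ) ^ 2 := by
    intro s
    have hH := ENNReal.lintegral_mul_le_Lp_mul_Lq (volume.restrict (Ioc (-h) h))
      Real.HolderConjugate.two_two (f := fun _ => 1) (g := fun σ => p (s + σ))
      aemeasurable_const (by fun_prop)
    simp only [Pi.mul_apply, one_mul, ENNReal.one_rpow, lintegral_const,
      Measure.restrict_apply MeasurableSet.univ, univ_inter, hvol] at hH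
    calc _ ≤ (ENNReal.ofReal (2 * h) ^ (1 / 2 : ℝ) *
          (∫⁻ σ in Ioc (-h) h, p (s + σ) ^ (2 : ℝ)) ^ (1 / 2 : ℝ)) ^ 2 := by gcongr
      _ = _ := by
        rw [mul_pow, ← ENNReal.rpow_natCast, ← ENNReal.rpow_natCast, ← ENNReal.rpow_mul,
          ← ENNReal.rpow_mul]
        norm_num
  calc ∫⁻ s, (∫⁻ σ in Ioc (-h) h, p (s + σ)) ^ 2
      ≤ ∫⁻ s, ENNReal.ofReal (2 * h) * ∫⁻ σ in Ioc (-h) h, p (s + σ) ^ 2 := lintegral_mono hcs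
    _ = ENNReal.ofReal (2 * h) * ∫⁻ s, ∫⁻ σ in Ioc (-h) h, p (s + σ) ^ 2 :=
        lintegral_const_mul' _ _ ENNReal.ofReal_ne_top
    _ = ENNReal.ofReal (2 * h) * ∫⁻ σ in Ioc (-h) h, ∫⁻ s, p (s + σ) ^ 2 := by
        rw [lintegral_lintegral_swap]
        fun_prop
    _ = ENNReal.ofReal (2 * h) ^ 2 * ∫⁻ s, p s ^ 2 := by
        have : ∀ σ : ℝ, ∫⁻ s, p (s + σ) ^ 2 = ∫⁻ s, p s ^ 2 := fun σ =>
          lintegral_add_right_eq_self (fun s => p s ^ 2) σ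
        simp only [this, lintegral_const, Measure.restrict_apply MeasurableSet.univ, univ_inter,
          hvol]
        ring

theorem MeasureTheory.MemLp.integrable_inner_two {α : Type*} [MeasurableSpace α] {ν : Measure α}
    {f g : α → E} (hf : MemLp f 2 ν) (hg : MemLp g 2 ν) :
    Integrable (fun a => ⟪f a, g a⟫) ν :=
  (hf.norm.integrable_mul hg.norm).mono (hf.1.inner hg.1) <| ae_of_all _ fun a => by
    simpa using norm_inner_le_norm (𝕜 := ℝ) (f a) (g a)

theorem MeasureTheory.MemLp.integral_norm_sub_sq {α : Type*} [MeasurableSpace α] {ν : Measure α}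
    {f g : α → E} (hf : MemLp f 2 ν) (hg : MemLp g 2 ν) :
    ∫ a, ‖f a - g a‖ ^ 2 ∂ν
      = (∫ a, ‖f a‖ ^ 2 ∂ν) - 2 * (∫ a, ⟪f a, g a⟫ ∂ν) + ∫ a, ‖g a‖ ^ 2 ∂ν := by
  have hi1 := (memLp_two_iff_integrable_sq_norm hf.1).1 hf
  have hi2 := (memLp_two_iff_integrable_sq_norm hg.1).1 hg
  have hi3 := (hf.integrable_inner_two hg).const_mul 2
  simp only [norm_sub_sq_real]
  rw [integral_add (by exact hi1.sub hi3) hi2, integral_sub hi1 hi3, integral_const_mul]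

theorem MeasureTheory.MemLp.lintegral_enorm_sq_eq {F α : Type*} [NormedAddCommGroup F]
    [MeasurableSpace α] {ν : Measure α} {f : α → F} (hf : MemLp f 2 ν) :
    ∫⁻ a, ‖f a‖ₑ ^ 2 ∂ν = ENNReal.ofReal (∫ a, ‖f a‖ ^ 2 ∂ν) := by
  rw [ofReal_integral_eq_lintegral_ofReal ((memLp_two_iff_integrable_sq_norm hf.1).1 hf)
    (ae_of_all _ fun a => by positivity)]
  refine lintegral_congr fun a => ?_
  rw [← ofReal_norm, ENNReal.ofReal_pow (norm_nonneg _)]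

/-- If `P = ∂ₛV` and the bilinear form `(V, G) ↦ ∫ ⟪V s, G s'⟫` is symmetric in `s` and `s'`,
then `∫ ⟪P, G⟫` is nonnegative. -/
theorem integral_inner_nonneg_of_symm {V P G : ℝ × ℝ → E}
    (hV : MemLp V 2) (hPm : StronglyMeasurable P) (hP : MemLp P 2) (hG : MemLp G 2)
    (hVm : StronglyMeasurable V)
    (hderiv : ∀ᵐ q : ℝ × ℝ, HasDerivAt (fun s => V (s, q.2)) (P q) q.1)
    (hftc : ∀ᵐ t : ℝ, ∀ a b : ℝ, a ≤ b → V (b, t) - V (a, t) = ∫ σ in a..b, P (σ, t))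
    (N : Set ℝ) (hN : ∀ᵐ s : ℝ, s ∈ N)
    (hsymm : ∀ s ∈ N, ∀ s' ∈ N, ∫ t, ⟪V (s, t), G (s', t)⟫ = ∫ t, ⟪G (s, t), V (s', t)⟫) :
    0 ≤ ∫ q, ⟪P q, G q⟫ := by
  have hmp : ∀ h : ℝ, MeasurePreserving (fun q : ℝ × ℝ => q + (h, 0)) volume volume :=
    fun h => measurePreserving_add_right volume (h, (0 : ℝ))
  have hVh : ∀ h : ℝ, MemLp (fun q : ℝ × ℝ => V (q + (h, 0))) 2 :=
    fun h => hV.comp_measurePreserving (hmp h)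
  have hGh : ∀ h : ℝ, MemLp (fun q : ℝ × ℝ => G (q + (h, 0))) 2 :=
    fun h => hG.comp_measurePreserving (hmp h)
  have hcross : ∀ h : ℝ, ∫ q, ⟪V (q + (h, 0)), G q⟫ = ∫ q, ⟪V (q + (-h, 0)), G q⟫ := by
    intro h
    have h1 : ∫ q, ⟪V (q + (h, 0)), G q⟫ = ∫ q, ⟪G (q + (h, 0)), V q⟫ := by
      rw [Measure.volume_eq_prod, integral_prod _ ((hVh h).integrable_inner_two hG),
        integral_prod _ ((hGh h).integrable_inner_two hV)]
      have hNh : ∀ᵐ s : ℝ, s + h ∈ N :=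
        (measurePreserving_add_right volume h).quasiMeasurePreserving.ae hN
      refine integral_congr_ae ?_
      filter_upwards [hN, hNh] with s hs hsh
      simpa using hsymm _ hsh _ hs
    rw [h1, ← (hmp h).integral_comp (MeasurableEquiv.addRight (h, (0 : ℝ))).measurableEmbedding
      (fun q => ⟪V (q + (-h, 0)), G q⟫)]
    refine integral_congr_ae (ae_of_all _ fun q => ?_)
    simp [add_assoc, real_inner_comm, Prod.mk_zero_zero]
  set c : ℕ → ℝ := fun k => 1 / ((k : ℝ) + 1) with hc
  have hcpos : ∀ k, 0 < c k := fun k => Nat.one_div_pos_of_nat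
  have hc0 : Tendsto c atTop (𝓝 0) := tendsto_one_div_add_atTop_nhds_zero_nat
  set D : ℕ → ℝ × ℝ → E :=
    fun k q => (2 * c k)⁻¹ • (V (q + (c k, 0)) - V (q + (-c k, 0))) with hD
  have hDmem : ∀ k, MemLp (D k) 2 := fun k => ((hVh _).sub (hVh _)).const_smul _
  have hDG : ∀ k, ∫ q, ⟪D k q, G q⟫ = 0 := by
    intro k
    simp only [hD, real_inner_smul_left, inner_sub_left]
    rw [integral_const_mul, integral_sub ((hVh _).integrable_inner_two hG)
      ((hVh _).integrable_inner_two hG), hcross (c k), sub_self, mul_zero]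
  have hDnorm : ∀ k, ∫⁻ q, ‖D k q‖ₑ ^ 2 ≤ ∫⁻ q, ‖P q‖ₑ ^ 2 := by
    intro k
    have hDsm : StronglyMeasurable (D k) := by
      refine ((hVm.comp_measurable (hmp _).measurable).sub
        (hVm.comp_measurable (hmp _).measurable)).const_smul _
    rw [Measure.volume_eq_prod, lintegral_prod_symm _ (hDsm.enorm.pow_const 2).aemeasurable,
      lintegral_prod_symm _ (hPm.enorm.pow_const 2).aemeasurable]
    refine lintegral_mono_ae ?_
    filter_upwards [hftc] with t ht
    have hpt : ∀ s, ‖D k (s, t)‖ₑ ^ 2 ≤ (ENNReal.ofReal (2 * c k)⁻¹) ^ 2 *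
        (∫⁻ σ in Ioc (-c k) (c k), ‖P (s + σ, t)‖ₑ) ^ 2 := by
      intro s
      rw [← mul_pow]
      gcongr
      simp only [hD, Prod.mk_add_mk, add_zero]
      rw [ht _ _ (by linarith [hcpos k]), enorm_smul,
        Real.enorm_eq_ofReal (by have := hcpos k; positivity)]
      gcongr
      rw [← intervalIntegral.integral_comp_add_left (fun σ => P (σ, t)) s,
        intervalIntegral.integral_of_le (by linarith [hcpos k])]
      exact enorm_integral_le_lintegral_enorm _
    have hPt : Measurable fun s => ‖P (s, t)‖ₑ :=
      hPm.enorm.comp (measurable_id.prodMk measurable_const)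
    calc ∫⁻ s, ‖D k (s, t)‖ₑ ^ 2
        ≤ ∫⁻ s, (ENNReal.ofReal (2 * c k)⁻¹) ^ 2 *
          (∫⁻ σ in Ioc (-c k) (c k), ‖P (s + σ, t)‖ₑ) ^ 2 := lintegral_mono hpt
      _ = (ENNReal.ofReal (2 * c k)⁻¹) ^ 2 *
          ∫⁻ s, (∫⁻ σ in Ioc (-c k) (c k), ‖P (s + σ, t)‖ₑ) ^ 2 :=
          lintegral_const_mul' _ _ (by finiteness)
      _ ≤ (ENNReal.ofReal (2 * c k)⁻¹) ^ 2 *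
          (ENNReal.ofReal (2 * c k) ^ 2 * ∫⁻ s, ‖P (s, t)‖ₑ ^ 2) := by
          gcongr
          exact lintegral_window_sq_le hPt _
      _ = ∫⁻ s, ‖P (s, t)‖ₑ ^ 2 := by
          rw [← mul_assoc, ← mul_pow, ← ENNReal.ofReal_mul (by have := hcpos k; positivity),
            inv_mul_cancel₀ (by have := hcpos k; positivity)]
          simp
  have hDP : ∀ᵐ q : ℝ × ℝ, Tendsto (fun k => D k q) atTop (𝓝 (P q)) := by
    filter_upwards [hderiv] with q hq
    have hslope := hq.tendsto_slope_zero
    have hplus : Tendsto c atTop (𝓝[≠] 0) :=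
      tendsto_nhdsWithin_iff.2 ⟨hc0, Eventually.of_forall fun k => (hcpos k).ne'⟩
    have hminus : Tendsto (fun k => -c k) atTop (𝓝[≠] 0) :=
      tendsto_nhdsWithin_iff.2
        ⟨by simpa using hc0.neg, Eventually.of_forall fun k => (neg_lt_zero.2 (hcpos k)).ne⟩
    have h2 := ((hslope.comp hplus).add (hslope.comp hminus)).const_smul (2⁻¹ : ℝ)
    have h3 : (2⁻¹ : ℝ) • (P q + P q) = P q := by
      rw [← two_smul ℝ, smul_smul]; norm_num
    rw [h3] at h2
    refine h2.congr fun k => ?_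
    obtain ⟨s, t⟩ := q
    simp only [hD, Function.comp, Prod.mk_add_mk, add_zero, mul_inv, inv_neg, smul_sub, smul_add,
      smul_smul, neg_smul, smul_neg]
    abel
  have hfatou : ∫⁻ q, ‖P q - G q‖ₑ ^ 2
      ≤ (∫⁻ q, ‖P q‖ₑ ^ 2) + ∫⁻ q, ‖G q‖ₑ ^ 2 := by
    have hexp : ∀ k, ∫⁻ q, ‖D k q - G q‖ₑ ^ 2 ≤ (∫⁻ q, ‖P q‖ₑ ^ 2) + ∫⁻ q, ‖G q‖ₑ ^ 2 := by
      intro k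
      have hm : MemLp (fun q => D k q - G q) 2 := (hDmem k).sub hG
      rw [hm.lintegral_enorm_sq_eq, (hDmem k).integral_norm_sub_sq hG, hDG k, mul_zero, sub_zero,
        ENNReal.ofReal_add (by positivity) (by positivity), ← (hDmem k).lintegral_enorm_sq_eq,
        ← hG.lintegral_enorm_sq_eq]
      exact add_le_add (hDnorm k) le_rfl
    calc ∫⁻ q, ‖P q - G q‖ₑ ^ 2
        = ∫⁻ q, liminf (fun k => ‖D k q - G q‖ₑ ^ 2) atTop := by
          refine lintegral_congr_ae ?_
          filter_upwards [hDP] with q hq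
          exact ((ENNReal.continuous_pow 2).tendsto _ |>.comp
            (hq.sub_const (G q)).enorm).liminf_eq.symm
      _ ≤ liminf (fun k => ∫⁻ q, ‖D k q - G q‖ₑ ^ 2) atTop :=
          lintegral_liminf_le' fun k => ((hDmem k).sub hG).1.enorm.pow_const 2
      _ ≤ _ := by
          refine liminf_le_of_le (by isBoundedDefault) fun b hb => ?_
          obtain ⟨k, hk⟩ := hb.exists
          exact hk.trans (hexp k)
  have hm : MemLp (fun q => P q - G q) 2 := hP.sub hG
  rw [hm.lintegral_enorm_sq_eq, hP.lintegral_enorm_sq_eq, hG.lintegral_enorm_sq_eq,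
    ← ENNReal.ofReal_add (by positivity) (by positivity),
    ENNReal.ofReal_le_ofReal_iff (by positivity), hP.integral_norm_sub_sq hG] at hfatou
  linarith

section Rectangle

variable {F : Type*} [NormedAddCommGroup F] [NormedSpace ℝ F] [FiniteDimensional ℝ F]
  {T : ℝ} {v : ℝ × ℝ → F} {Dv : ℝ × ℝ → ℝ × ℝ →L[ℝ] F}

theorem isOpen_Ioo_prod_Ioo (a b c d : ℝ) : IsOpen (Ioo a b ×ˢ Ioo c d) :=
  isOpen_Ioo.prod isOpen_Ioo

theorem measurableSet_Ioo_prod_Ioo (a b c d : ℝ) : MeasurableSet (Ioo a b ×ˢ Ioo c d) :=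
  measurableSet_Ioo.prod measurableSet_Ioo

theorem volume_Ioo_prod_Ioo_lt_top (a b c d : ℝ) : volume (Ioo a b ×ˢ Ioo c d) < ∞ := by
  rw [Measure.volume_eq_prod, Measure.prod_prod, Real.volume_Ioo, Real.volume_Ioo]
  finiteness

theorem ae_mem_rectangle_iff (T : ℝ) : ∀ᵐ q : ℝ × ℝ,
    q ∈ Ioo 0 T ×ˢ Ioo (0 : ℝ) 1 ↔ q ∈ Icc 0 T ×ˢ Icc (0 : ℝ) 1 := by
  rw [Measure.volume_eq_prod]
  exact eventuallyEq_set.1 (Measure.set_prod_ae_eq Ioo_ae_eq_Icc Ioo_ae_eq_Icc)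

theorem Ioo_prod_Ioo_subset_Icc_prod_Icc (a b c d : ℝ) :
    Ioo a b ×ˢ Ioo c d ⊆ Icc a b ×ˢ Icc c d :=
  prod_mono Ioo_subset_Icc_self Ioo_subset_Icc_self

omit [FiniteDimensional ℝ F] in
theorem hasFDerivAt_of_mem_rectangle
    (hd : ∀ q ∈ Icc 0 T ×ˢ Icc (0 : ℝ) 1,
      HasFDerivWithinAt v (Dv q) (Icc 0 T ×ˢ Icc (0 : ℝ) 1) q)
    {q : ℝ × ℝ} (hq : q ∈ Ioo 0 T ×ˢ Ioo (0 : ℝ) 1) : HasFDerivAt v (Dv q) q :=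
  (hd q (Ioo_prod_Ioo_subset_Icc_prod_Icc _ _ _ _ hq)).hasFDerivAt <|
    mem_of_superset ((isOpen_Ioo_prod_Ioo _ _ _ _).mem_nhds hq)
      (Ioo_prod_Ioo_subset_Icc_prod_Icc _ _ _ _)

omit [FiniteDimensional ℝ F] in
theorem HasFDerivAt.hasDerivAt_slice_fst {s t : ℝ} {L : ℝ × ℝ →L[ℝ] F}
    (h : HasFDerivAt v L (s, t)) : HasDerivAt (fun s => v (s, t)) (L (1, 0)) s :=
  h.comp_hasDerivAt s ((hasDerivAt_id s).prodMk (hasDerivAt_const s t))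

omit [FiniteDimensional ℝ F] in
theorem HasFDerivAt.hasDerivAt_slice_snd {s t : ℝ} {L : ℝ × ℝ →L[ℝ] F}
    (h : HasFDerivAt v L (s, t)) : HasDerivAt (fun t => v (s, t)) (L (0, 1)) t :=
  h.comp_hasDerivAt t ((hasDerivAt_const t s).prodMk (hasDerivAt_id t))

theorem stronglyMeasurable_indicator_fderiv_apply
    (hd : ∀ q ∈ Icc 0 T ×ˢ Icc (0 : ℝ) 1,
      HasFDerivWithinAt v (Dv q) (Icc 0 T ×ˢ Icc (0 : ℝ) 1) q) (e : ℝ × ℝ) :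
    StronglyMeasurable ((Ioo 0 T ×ˢ Ioo (0 : ℝ) 1).indicator fun q => Dv q e) := by
  borelize F
  have : ProperSpace F := FiniteDimensional.proper ℝ F
  have : CompleteSpace F := FiniteDimensional.complete ℝ F
  have heq : ((Ioo 0 T ×ˢ Ioo (0 : ℝ) 1).indicator fun q => Dv q e)
      = (Ioo 0 T ×ˢ Ioo (0 : ℝ) 1).indicator fun q => fderiv ℝ v q e :=
    indicator_congr fun q hq => by rw [(hasFDerivAt_of_mem_rectangle hd hq).fderiv]
  rw [heq]
  exact ((measurable_fderiv_apply_const ℝ v e).indicator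
    (measurableSet_Ioo_prod_Ioo _ _ _ _)).stronglyMeasurable

theorem memLp_indicator_fderiv_apply
    (hd : ∀ q ∈ Icc 0 T ×ˢ Icc (0 : ℝ) 1,
      HasFDerivWithinAt v (Dv q) (Icc 0 T ×ˢ Icc (0 : ℝ) 1) q) {e : ℝ × ℝ}
    (h2 : IntegrableOn (fun q => ‖Dv q e‖ ^ 2) (Ioo 0 T ×ˢ Ioo (0 : ℝ) 1)) :
    MemLp ((Ioo 0 T ×ˢ Ioo (0 : ℝ) 1).indicator fun q => Dv q e) 2 := by
  rw [memLp_indicator_iff_restrict (measurableSet_Ioo_prod_Ioo _ _ _ _),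
    memLp_two_iff_integrable_sq_norm]
  · exact h2
  · exact (aestronglyMeasurable_indicator_iff (measurableSet_Ioo_prod_Ioo _ _ _ _)).1
      (stronglyMeasurable_indicator_fderiv_apply hd e).aestronglyMeasurable

theorem ContinuousOn.stronglyMeasurable_indicator_rectangle
    (hv : ContinuousOn v (Icc 0 T ×ˢ Icc (0 : ℝ) 1)) :
    StronglyMeasurable ((Ioo 0 T ×ˢ Ioo (0 : ℝ) 1).indicator v) := by
  borelize F
  have : ProperSpace F := FiniteDimensional.proper ℝ F
  rw [← piecewise_eq_indicator]
  exact ((hv.mono (Ioo_prod_Ioo_subset_Icc_prod_Icc _ _ _ _)).measurable_piecewise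
    continuousOn_const (measurableSet_Ioo_prod_Ioo _ _ _ _)).stronglyMeasurable

theorem ContinuousOn.memLp_indicator_rectangle
    (hv : ContinuousOn v (Icc 0 T ×ˢ Icc (0 : ℝ) 1)) (p : ℝ≥0∞) :
    MemLp ((Ioo 0 T ×ˢ Ioo (0 : ℝ) 1).indicator v) p := by
  have hU := measurableSet_Ioo_prod_Ioo 0 T 0 1
  have : IsFiniteMeasure (volume.restrict (Ioo 0 T ×ˢ Ioo (0 : ℝ) 1)) :=
    ⟨by simpa using volume_Ioo_prod_Ioo_lt_top 0 T 0 1⟩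
  obtain ⟨C, hC⟩ := (isCompact_Icc.prod isCompact_Icc).exists_bound_of_continuousOn hv
  rw [memLp_indicator_iff_restrict hU]
  refine MemLp.of_bound ((aestronglyMeasurable_indicator_iff hU).1
    hv.stronglyMeasurable_indicator_rectangle.aestronglyMeasurable) C ?_
  exact (ae_restrict_iff' hU).2 (ae_of_all _ fun q hq =>
    hC q (Ioo_prod_Ioo_subset_Icc_prod_Icc _ _ _ _ hq))

omit [NormedSpace ℝ F] [FiniteDimensional ℝ F] in
theorem MeasureTheory.MemLp.integrable_indicator_rectangle {f : ℝ × ℝ → F}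
    (h : MemLp ((Ioo 0 T ×ˢ Ioo (0 : ℝ) 1).indicator f) 2) :
    Integrable ((Ioo 0 T ×ˢ Ioo (0 : ℝ) 1).indicator f) := by
  have hU := measurableSet_Ioo_prod_Ioo 0 T 0 1
  have : IsFiniteMeasure (volume.restrict (Ioo 0 T ×ˢ Ioo (0 : ℝ) 1)) :=
    ⟨by simpa using volume_Ioo_prod_Ioo_lt_top 0 T 0 1⟩
  exact (integrable_indicator_iff hU).2
    (((memLp_indicator_iff_restrict hU).1 h).integrable one_le_two)

omit [NormedSpace ℝ F] [FiniteDimensional ℝ F] in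
theorem continuous_indicator_slice (hT : 0 ≤ T)
    (hv : ContinuousOn v (Icc 0 T ×ˢ Icc (0 : ℝ) 1)) {t : ℝ} (ht : t ∈ Ioo (0 : ℝ) 1)
    (h0 : v (0, t) = 0) (hT0 : v (T, t) = 0) :
    Continuous fun s => (Ioo 0 T ×ˢ Ioo (0 : ℝ) 1).indicator v (s, t) := by
  have heq : (fun s => (Ioo 0 T ×ˢ Ioo (0 : ℝ) 1).indicator v (s, t))
      = fun s => v (max 0 (min T s), t) := by
    funext s
    by_cases hs : s ∈ Ioo 0 T
    · rw [indicator_of_mem (mk_mem_prod hs ht), min_eq_right hs.2.le, max_eq_right hs.1.le]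
    · rw [indicator_of_notMem (fun h => hs h.1)]
      rcases le_or_gt s 0 with h | h
      · rw [max_eq_left ((min_le_right _ _).trans h), h0]
      · rw [min_eq_left (not_lt.1 fun h' => hs ⟨h, h'⟩), max_eq_right hT, hT0]
  rw [heq]
  refine hv.comp_continuous (by fun_prop) fun s => ?_
  exact ⟨⟨le_max_left _ _, max_le hT (min_le_left _ _)⟩, Ioo_subset_Icc_self ht⟩

theorem indicator_slice_sub_eq_integral (hT : 0 ≤ T)
    (hd : ∀ q ∈ Icc 0 T ×ˢ Icc (0 : ℝ) 1,
      HasFDerivWithinAt v (Dv q) (Icc 0 T ×ˢ Icc (0 : ℝ) 1) q)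
    (h0 : ∀ t ∈ Icc (0 : ℝ) 1, v (0, t) = 0) (hT0 : ∀ t ∈ Icc (0 : ℝ) 1, v (T, t) = 0) {t : ℝ}
    (hint : Integrable fun s => (Ioo 0 T ×ˢ Ioo (0 : ℝ) 1).indicator (fun q => Dv q (1, 0)) (s, t))
    {a b : ℝ} (hab : a ≤ b) :
    (Ioo 0 T ×ˢ Ioo (0 : ℝ) 1).indicator v (b, t) - (Ioo 0 T ×ˢ Ioo (0 : ℝ) 1).indicator v (a, t)
      = ∫ s in a..b, (Ioo 0 T ×ˢ Ioo (0 : ℝ) 1).indicator (fun q => Dv q (1, 0)) (s, t) := by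
  have : CompleteSpace F := FiniteDimensional.complete ℝ F
  by_cases ht : t ∈ Ioo (0 : ℝ) 1
  swap
  · simp [indicator, ht]
  have ht' := Ioo_subset_Icc_self ht
  refine (integral_eq_of_hasDerivAt_off_countable_of_le
    (fun s => (Ioo 0 T ×ˢ Ioo (0 : ℝ) 1).indicator v (s, t)) _ hab (s := {0, T})
    (Set.to_countable _)
    (continuous_indicator_slice hT (fun q hq => (hd q hq).continuousWithinAt) ht
      (h0 t ht') (hT0 t ht')).continuousOn (fun s hs => ?_) hint.intervalIntegrable).symm
  by_cases hs' : s ∈ Ioo 0 T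
  · have hq : (s, t) ∈ Ioo 0 T ×ˢ Ioo (0 : ℝ) 1 := ⟨hs', ht⟩
    rw [indicator_of_mem hq]
    refine (hasFDerivAt_of_mem_rectangle hd hq).hasDerivAt_slice_fst.congr_of_eventuallyEq ?_
    filter_upwards [isOpen_Ioo.mem_nhds hs'] with r hr
    exact indicator_of_mem (mk_mem_prod hr ht) _
  · rw [indicator_of_notMem (fun h => hs' h.1)]
    have hs2 : s ∈ (Icc 0 T)ᶜ := by
      rintro ⟨h1, h2⟩
      exact hs' ⟨h1.lt_of_ne fun h => hs.2 (Or.inl h.symm), h2.lt_of_ne fun h => hs.2 (Or.inr h)⟩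
    refine (hasDerivAt_const s (0 : F)).congr_of_eventuallyEq ?_
    filter_upwards [isClosed_Icc.isOpen_compl.mem_nhds hs2] with r hr
    exact indicator_of_notMem (fun h => hr (Ioo_subset_Icc_self h.1)) _

end Rectangle

/-- For a map on a rectangle vanishing on the sides `s = 0` and `s = T` and with values in an
isotropic subspace on the other two sides, `∫ ⟪∂ₛv, J∂ₜv⟫` has a sign. -/
theorem setIntegral_inner_fderiv_nonneg [FiniteDimensional ℝ E] {J : E →L[ℝ] E}
    (hJ : ∀ v w, ⟪J v, w⟫ = -⟪v, J w⟫) {Λ : Submodule ℝ E} (hΛ : ∀ v ∈ Λ, ∀ w ∈ Λ, ⟪v, J w⟫ = 0)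
    {T : ℝ} (hT : 0 ≤ T) {v : ℝ × ℝ → E} {Dv : ℝ × ℝ → ℝ × ℝ →L[ℝ] E}
    (hd : ∀ q ∈ Icc 0 T ×ˢ Icc (0 : ℝ) 1,
      HasFDerivWithinAt v (Dv q) (Icc 0 T ×ˢ Icc (0 : ℝ) 1) q)
    (h2s : IntegrableOn (fun q => ‖Dv q (1, 0)‖ ^ 2) (Ioo 0 T ×ˢ Ioo (0 : ℝ) 1))
    (h2t : IntegrableOn (fun q => ‖Dv q (0, 1)‖ ^ 2) (Ioo 0 T ×ˢ Ioo (0 : ℝ) 1))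
    (hbc : ∀ s ∈ Icc 0 T, v (s, 0) ∈ Λ ∧ v (s, 1) ∈ Λ)
    (h0 : ∀ t ∈ Icc (0 : ℝ) 1, v (0, t) = 0) (hT0 : ∀ t ∈ Icc (0 : ℝ) 1, v (T, t) = 0) :
    0 ≤ ∫ q in Ioo 0 T ×ˢ Ioo (0 : ℝ) 1, ⟪Dv q (1, 0), J (Dv q (0, 1))⟫ := by
  have hcont : ContinuousOn v (Icc 0 T ×ˢ Icc (0 : ℝ) 1) :=
    fun q hq => (hd q hq).continuousWithinAt
  set U := Ioo 0 T ×ˢ Ioo (0 : ℝ) 1 with hU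
  have hUm : MeasurableSet U := measurableSet_Ioo_prod_Ioo _ _ _ _
  have hP2 := memLp_indicator_fderiv_apply hd h2s
  have hQ2 := memLp_indicator_fderiv_apply hd h2t
  have hG2 : MemLp (fun q => J (U.indicator (fun q => Dv q (0, 1)) q)) 2 :=
    J.comp_memLp' hQ2
  have hN : ∀ᵐ s : ℝ, Integrable fun t => U.indicator (fun q => Dv q (0, 1)) (s, t) :=
    hQ2.integrable_indicator_rectangle.prod_right_ae
  have key := integral_inner_nonneg_of_symm (hcont.memLp_indicator_rectangle 2)
    (stronglyMeasurable_indicator_fderiv_apply hd (1, 0)) hP2 hG2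
    hcont.stronglyMeasurable_indicator_rectangle ?_ ?_ _ hN ?_
  · rw [← integral_indicator hUm]
    refine key.trans_eq (integral_congr_ae (ae_of_all _ fun q => ?_))
    by_cases hq : q ∈ U
    · simp [hq, ← hU]
    · simp [hq, ← hU]
  · filter_upwards [ae_mem_rectangle_iff T] with q hq
    by_cases hqU : q ∈ U
    · rw [indicator_of_mem hqU]
      refine (hasFDerivAt_of_mem_rectangle hd hqU).hasDerivAt_slice_fst.congr_of_eventuallyEq ?_
      filter_upwards [isOpen_Ioo.mem_nhds hqU.1] with r hr
      exact indicator_of_mem (mk_mem_prod hr hqU.2) _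
    · rw [indicator_of_notMem hqU]
      have hqc : (q.1, q.2) ∈ (Icc 0 T ×ˢ Icc (0 : ℝ) 1)ᶜ := fun h => hqU (hq.2 h)
      have hev : ∀ᶠ r in 𝓝 q.1, (r, q.2) ∈ (Icc 0 T ×ˢ Icc (0 : ℝ) 1)ᶜ :=
        (Continuous.prodMk_left q.2).continuousAt.preimage_mem_nhds
          ((isClosed_Icc.prod isClosed_Icc).isOpen_compl.mem_nhds hqc)
      refine (hasDerivAt_const q.1 (0 : E)).congr_of_eventuallyEq ?_
      filter_upwards [hev] with r hr
      exact indicator_of_notMem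
        (fun h => hr (Ioo_prod_Ioo_subset_Icc_prod_Icc _ _ _ _ h)) _
  · filter_upwards [hP2.integrable_indicator_rectangle.prod_left_ae] with t ht a b hab
    exact indicator_slice_sub_eq_integral hT hd h0 hT0 ht hab
  · intro s hs s' hs'
    have hout : ∀ r ∉ Ioo 0 T, ∀ t, (r, t) ∉ U := fun r hr t h => hr h.1
    by_cases hsm : s ∈ Ioo 0 T
    swap
    · simp [hout s hsm, ← hU]
    by_cases hsm' : s' ∈ Ioo 0 T
    swap
    · simp [hout s' hsm', ← hU]
    obtain ⟨C, hC⟩ := (isCompact_Icc.prod isCompact_Icc).exists_bound_of_continuousOn hcont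
    have hbound : ∀ r t, ‖U.indicator v (r, t)‖ ≤ |C| := by
      intro r t
      by_cases h : (r, t) ∈ U
      · rw [indicator_of_mem h]
        exact (hC _ (Ioo_prod_Ioo_subset_Icc_prod_Icc _ _ _ _ h)).trans (le_abs_self C)
      · simp [h]
    have hVm : ∀ r, AEStronglyMeasurable (fun t => U.indicator v (r, t)) :=
      fun r => (hcont.stronglyMeasurable_indicator_rectangle.comp_measurable
        measurable_prodMk_left).aestronglyMeasurable
    have hA : Integrable fun t =>
        ⟪U.indicator v (s, t), J (U.indicator (fun q => Dv q (0, 1)) (s', t))⟫ := by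
      have hi := J.integrable_comp hs'
      refine (hi.norm.const_mul |C|).mono' ((hVm s).inner hi.1) (ae_of_all _ fun t => ?_)
      exact (norm_inner_le_norm _ _).trans (by gcongr; exact hbound s t)
    have hB : Integrable fun t =>
        ⟪J (U.indicator (fun q => Dv q (0, 1)) (s, t)), U.indicator v (s', t)⟫ := by
      have hi := J.integrable_comp hs
      refine (hi.norm.mul_const |C|).mono' (hi.1.inner (hVm s')) (ae_of_all _ fun t => ?_)
      exact (norm_inner_le_norm _ _).trans (by gcongr; exact hbound s' t)
    rw [← sub_eq_zero, ← integral_sub hA hB]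
    have hAB : Integrable fun t =>
        ⟪U.indicator v (s, t), J (U.indicator (fun q => Dv q (0, 1)) (s', t))⟫
          - ⟪J (U.indicator (fun q => Dv q (0, 1)) (s, t)), U.indicator v (s', t)⟫ := hA.sub hB
    have hin : ∀ r ∈ Ioo 0 T, ∀ t ∈ Ioo (0 : ℝ) 1, (r, t) ∈ U := fun r hr t ht => ⟨hr, ht⟩
    have hslice : ∀ r ∈ Ioo 0 T, ContinuousOn (fun t => v (r, t)) (Icc 0 1) := fun r hr =>
      hcont.comp (Continuous.prodMk_right r).continuousOn
        fun t ht => ⟨Ioo_subset_Icc_self hr, ht⟩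
    rw [← setIntegral_eq_integral_of_forall_compl_eq_zero (s := Ioc (0 : ℝ) 1)
        (fun t ht => by
          have : (s, t) ∉ U := fun h => ht (Ioo_subset_Ioc_self h.2)
          simp [this]),
      ← intervalIntegral.integral_of_le zero_le_one,
      intervalIntegral.integral_eq_sub_of_hasDerivAt_of_le zero_le_one
        (f := fun t => ⟪v (s, t), J (v (s', t))⟫)
        ((hslice s hsm).inner (𝕜 := ℝ) (J.continuous.comp_continuousOn (hslice s' hsm')))
        (fun t ht => ?_) hAB.intervalIntegrable]
    · have hb := hbc s (Ioo_subset_Icc_self hsm)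
      have hb' := hbc s' (Ioo_subset_Icc_self hsm')
      simp only [hΛ _ hb.1 _ hb'.1, hΛ _ hb.2 _ hb'.2, sub_zero]
    · have h1 := (hasFDerivAt_of_mem_rectangle hd (hin s hsm t ht)).hasDerivAt_slice_snd
      have h2 := (hasFDerivAt_of_mem_rectangle hd (hin s' hsm' t ht)).hasDerivAt_slice_snd
      have h3 := h1.inner ℝ (J.hasFDerivAt.comp_hasDerivAt t h2)
      refine h3.congr_deriv ?_
      simp only [indicator_of_mem (hin s hsm t ht), indicator_of_mem (hin s' hsm' t ht), hJ,
        Function.comp_apply, sub_neg_eq_add]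

theorem setIntegral_weighted_inner_fderiv [FiniteDimensional ℝ E]
    {T : ℝ} (hT : 0 ≤ T) {v : ℝ × ℝ → E} {Dv : ℝ × ℝ → ℝ × ℝ →L[ℝ] E}
    (hd : ∀ q ∈ Icc 0 T ×ˢ Icc (0 : ℝ) 1,
      HasFDerivWithinAt v (Dv q) (Icc 0 T ×ˢ Icc (0 : ℝ) 1) q)
    (h2s : IntegrableOn (fun q => ‖Dv q (1, 0)‖ ^ 2) (Ioo 0 T ×ˢ Ioo (0 : ℝ) 1))
    (h0 : ∀ t ∈ Icc (0 : ℝ) 1, v (0, t) = 0) :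
    ∫ q in Ioo 0 T ×ˢ Ioo (0 : ℝ) 1, 2 * ⟪Dv q (1, 0), (T - q.1) • v q⟫
      = ∫ q in Ioo 0 T ×ˢ Ioo (0 : ℝ) 1, ‖v q‖ ^ 2 := by
  have hcont : ContinuousOn v (Icc 0 T ×ˢ Icc (0 : ℝ) 1) :=
    fun q hq => (hd q hq).continuousWithinAt
  have hUm : MeasurableSet (Ioo 0 T ×ˢ Ioo (0 : ℝ) 1) := measurableSet_Ioo_prod_Ioo _ _ _ _
  have hP := (memLp_indicator_iff_restrict hUm).1 (memLp_indicator_fderiv_apply hd h2s)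
  have hw : ContinuousOn (fun q : ℝ × ℝ => (T - q.1) • v q) (Icc 0 T ×ˢ Icc (0 : ℝ) 1) :=
    ContinuousOn.smul (by fun_prop) hcont
  have hi1 := (hP.integrable_inner_two
    ((memLp_indicator_iff_restrict hUm).1 (hw.memLp_indicator_rectangle 2))).const_mul 2
  have hV := (memLp_indicator_iff_restrict hUm).1 (hcont.memLp_indicator_rectangle 2)
  have hi2 := (memLp_two_iff_integrable_sq_norm hV.1).1 hV
  have hi : IntegrableOn (fun q => 2 * ⟪Dv q (1, 0), (T - q.1) • v q⟫ - ‖v q‖ ^ 2)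
      (Ioo 0 T ×ˢ Ioo (0 : ℝ) 1) := hi1.sub hi2
  have hiI := (integrable_indicator_iff hUm).2 hi
  rw [← sub_eq_zero, ← integral_sub hi1 hi2, ← integral_indicator hUm, Measure.volume_eq_prod,
    integral_prod_symm _ hiI]
  refine integral_eq_zero_of_ae ?_
  filter_upwards [hiI.prod_left_ae] with t ht
  by_cases htm : t ∈ Ioo (0 : ℝ) 1
  swap
  · simp [indicator, htm]
  rw [← setIntegral_eq_integral_of_forall_compl_eq_zero (s := Ioc 0 T)
      (fun s hs => indicator_of_notMem (fun h => hs (Ioo_subset_Ioc_self h.1)) _),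
    ← intervalIntegral.integral_of_le hT,
    intervalIntegral.integral_eq_sub_of_hasDerivAt_of_le hT
      (f := fun s => (T - s) * ‖v (s, t)‖ ^ 2) ?_ (fun s hs => ?_) ht.intervalIntegrable]
  · simp [h0 t (Ioo_subset_Icc_self htm)]
  · have : ContinuousOn (fun s => v (s, t)) (Icc 0 T) :=
      hcont.comp (Continuous.prodMk_left t).continuousOn
        fun s hs => ⟨hs, Ioo_subset_Icc_self htm⟩
    exact ContinuousOn.mul (by fun_prop) (this.norm.pow 2)
  · have hq : (s, t) ∈ Ioo 0 T ×ˢ Ioo (0 : ℝ) 1 := ⟨hs, htm⟩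
    have h1 := (hasFDerivAt_of_mem_rectangle hd hq).hasDerivAt_slice_fst
    have h2 := ((hasDerivAt_id s).const_sub T).mul h1.norm_sq
    rw [indicator_of_mem hq]
    refine h2.congr_deriv ?_
    simp only [id, inner_smul_right, real_inner_comm (v (s, t))]
    ring

theorem hasDerivAt_sub_mul_exp_sq (T l s : ℝ) :
    HasDerivAt (fun s => (T - s) * Real.exp (l / 2 * (T - s) ^ 2))
      (-(1 + l * (T - s) ^ 2) * Real.exp (l / 2 * (T - s) ^ 2)) s := by
  have h := (hasDerivAt_id s).const_sub T
  have h2 := h.mul ((h.pow 2).const_mul (l / 2)).exp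
  refine h2.congr_deriv ?_
  simp
  ring

/-- A Carleman estimate for `∂ₛ + J∂ₜ` with the weight `exp (l (T - s)²)`. -/
theorem carleman_inequality [FiniteDimensional ℝ E] {J : E →L[ℝ] E}
    (hJ : ∀ v w, ⟪J v, w⟫ = -⟪v, J w⟫) {Λ : Submodule ℝ E} (hΛ : ∀ v ∈ Λ, ∀ w ∈ Λ, ⟪v, J w⟫ = 0)
    {T C : ℝ} (hT : 0 ≤ T) {u : ℝ × ℝ → E} {Du : ℝ × ℝ → ℝ × ℝ →L[ℝ] E}
    (hd : ∀ q ∈ Icc 0 T ×ˢ Icc (0 : ℝ) 1,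
      HasFDerivWithinAt u (Du q) (Icc 0 T ×ˢ Icc (0 : ℝ) 1) q)
    (h2s : IntegrableOn (fun q => ‖Du q (1, 0)‖ ^ 2) (Ioo 0 T ×ˢ Ioo (0 : ℝ) 1))
    (h2t : IntegrableOn (fun q => ‖Du q (0, 1)‖ ^ 2) (Ioo 0 T ×ˢ Ioo (0 : ℝ) 1))
    (hbc : ∀ s ∈ Icc 0 T, u (s, 0) ∈ Λ ∧ u (s, 1) ∈ Λ)
    (h0 : ∀ t ∈ Icc (0 : ℝ) 1, u (0, t) = 0)
    (heq : ∀ q ∈ Icc 0 T ×ˢ Icc (0 : ℝ) 1, ‖Du q (1, 0) + J (Du q (0, 1))‖ ≤ C * ‖u q‖)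
    (l : ℝ) :
    ∫ q in Ioo 0 T ×ˢ Ioo (0 : ℝ) 1,
      (l * (T - q.1) ^ 2 - (1 + T * C) ^ 2) * Real.exp (l * (T - q.1) ^ 2) * ‖u q‖ ^ 2 ≤ 0 := by
  have hcont : ContinuousOn u (Icc 0 T ×ˢ Icc (0 : ℝ) 1) :=
    fun q hq => (hd q hq).continuousWithinAt
  have hUm : MeasurableSet (Ioo 0 T ×ˢ Ioo (0 : ℝ) 1) := measurableSet_Ioo_prod_Ioo _ _ _ _
  have hUQ := Ioo_prod_Ioo_subset_Icc_prod_Icc 0 T 0 1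
  set w : ℝ → ℝ := fun s => (T - s) * Real.exp (l / 2 * (T - s) ^ 2) with hw
  set w' : ℝ → ℝ := fun s => -(1 + l * (T - s) ^ 2) * Real.exp (l / 2 * (T - s) ^ 2) with hw'
  set v : ℝ × ℝ → E := fun q => w q.1 • u q with hv
  set Dv : ℝ × ℝ → ℝ × ℝ →L[ℝ] E := fun q =>
    w q.1 • Du q + (w' q.1 • ContinuousLinearMap.fst ℝ ℝ ℝ).smulRight (u q) with hDv
  have hdv : ∀ q ∈ Icc 0 T ×ˢ Icc (0 : ℝ) 1,
      HasFDerivWithinAt v (Dv q) (Icc 0 T ×ˢ Icc (0 : ℝ) 1) q := fun q hq =>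
    ((hasDerivAt_sub_mul_exp_sq T l q.1).comp_hasFDerivWithinAt q hasFDerivWithinAt_fst).smul
      (hd q hq)
  have hDvs : ∀ q, Dv q (1, 0) = w q.1 • Du q (1, 0) + w' q.1 • u q := fun q => by simp [hDv]
  have hDvt : ∀ q, Dv q (0, 1) = w q.1 • Du q (0, 1) := fun q => by simp [hDv]
  have hcv : ContinuousOn v (Icc 0 T ×ˢ Icc (0 : ℝ) 1) :=
    fun q hq => (hdv q hq).continuousWithinAt
  have hintc : ∀ {f : ℝ × ℝ → ℝ}, ContinuousOn f (Icc 0 T ×ˢ Icc (0 : ℝ) 1) →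
      IntegrableOn f (Ioo 0 T ×ˢ Ioo (0 : ℝ) 1) := fun hf =>
    (hf.integrableOn_compact (isCompact_Icc.prod isCompact_Icc)).mono_set hUQ
  obtain ⟨M, hM⟩ := (isCompact_Icc.prod isCompact_Icc).exists_bound_of_continuousOn
    (f := fun q : ℝ × ℝ => w q.1) (s := Icc 0 T ×ˢ Icc (0 : ℝ) 1)
    (by simp only [hw]; fun_prop)
  have hmeas : ∀ e, AEStronglyMeasurable (fun q => Dv q e)
      (volume.restrict (Ioo 0 T ×ˢ Ioo (0 : ℝ) 1)) := fun e =>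
    (aestronglyMeasurable_indicator_iff hUm).1
      (stronglyMeasurable_indicator_fderiv_apply hdv e).aestronglyMeasurable
  have hv2s : IntegrableOn (fun q => ‖Dv q (1, 0)‖ ^ 2) (Ioo 0 T ×ˢ Ioo (0 : ℝ) 1) := by
    have hc : ContinuousOn (fun q : ℝ × ℝ => 2 * ‖w' q.1 • u q‖ ^ 2)
        (Icc 0 T ×ˢ Icc (0 : ℝ) 1) := by
      refine ContinuousOn.mul continuousOn_const
        (ContinuousOn.pow (ContinuousOn.norm (ContinuousOn.smul ?_ hcont)) 2)
      simp only [hw']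
      fun_prop
    refine ((h2s.const_mul (2 * M ^ 2)).add (hintc hc)).mono' ((hmeas _).norm.pow 2)
      ((ae_restrict_iff' hUm).2 (ae_of_all _ fun q hq => ?_))
    have h1 : ‖w q.1 • Du q (1, 0)‖ ^ 2 ≤ M ^ 2 * ‖Du q (1, 0)‖ ^ 2 := by
      rw [norm_smul, mul_pow]
      gcongr
      exact hM q (hUQ hq)
    have h2 := parallelogram_law_with_norm ℝ (w q.1 • Du q (1, 0)) (w' q.1 • u q)
    have h3 := norm_nonneg (w q.1 • Du q (1, 0) - w' q.1 • u q)
    simp only [Pi.add_apply]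
    rw [Real.norm_of_nonneg (by positivity), hDvs]
    nlinarith
  have hv2t : IntegrableOn (fun q => ‖Dv q (0, 1)‖ ^ 2) (Ioo 0 T ×ˢ Ioo (0 : ℝ) 1) := by
    refine (h2t.const_mul (M ^ 2)).mono' ((hmeas _).norm.pow 2)
      ((ae_restrict_iff' hUm).2 (ae_of_all _ fun q hq => ?_))
    rw [Real.norm_of_nonneg (by positivity), hDvt, norm_smul, mul_pow]
    gcongr
    exact hM q (hUQ hq)
  have hv0 : ∀ t ∈ Icc (0 : ℝ) 1, v (0, t) = 0 := fun t ht => by simp [hv, h0 t ht]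
  have hvT : ∀ t ∈ Icc (0 : ℝ) 1, v (T, t) = 0 := fun t ht => by simp [hv, hw]
  have hvbc : ∀ s ∈ Icc 0 T, v (s, 0) ∈ Λ ∧ v (s, 1) ∈ Λ := fun s hs =>
    ⟨Λ.smul_mem _ (hbc s hs).1, Λ.smul_mem _ (hbc s hs).2⟩
  have hE := setIntegral_inner_fderiv_nonneg hJ hΛ hT hdv hv2s hv2t hvbc hv0 hvT
  have hW := setIntegral_weighted_inner_fderiv hT hdv hv2s hv0
  have hA : MemLp (fun q => Dv q (1, 0)) 2 (volume.restrict (Ioo 0 T ×ˢ Ioo (0 : ℝ) 1)) :=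
    (memLp_two_iff_integrable_sq_norm (hmeas _)).2 hv2s
  have hB : MemLp (fun q => J (Dv q (0, 1))) 2 (volume.restrict (Ioo 0 T ×ˢ Ioo (0 : ℝ) 1)) :=
    J.comp_memLp' ((memLp_two_iff_integrable_sq_norm (hmeas _)).2 hv2t)
  have hTv : MemLp (fun q => (T - q.1) • v q) 2 (volume.restrict (Ioo 0 T ×ˢ Ioo (0 : ℝ) 1)) :=
    (memLp_indicator_iff_restrict hUm).1 (ContinuousOn.memLp_indicator_rectangle
      (ContinuousOn.smul (by fun_prop) hcv) 2)
  have hiAB := (hA.integrable_inner_two hB).const_mul 2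
  have hiAv := ((hA.integrable_inner_two hTv).const_mul 2).const_mul l
  have hiv : IntegrableOn (fun q => l * ‖v q‖ ^ 2) (Ioo 0 T ×ˢ Ioo (0 : ℝ) 1) :=
    hintc (continuousOn_const.mul (hcv.norm.pow 2))
  have hiu : IntegrableOn
      (fun q => (1 + T * C) ^ 2 * (Real.exp (l * (T - q.1) ^ 2) * ‖u q‖ ^ 2))
      (Ioo 0 T ×ˢ Ioo (0 : ℝ) 1) :=
    hintc (continuousOn_const.mul (ContinuousOn.mul (by fun_prop) (hcont.norm.pow 2)))
  have hexp : ∀ s, Real.exp (l * (T - s) ^ 2) = Real.exp (l / 2 * (T - s) ^ 2) ^ 2 := fun s => by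
    rw [← Real.exp_nat_mul]; congr 1; push_cast; ring
  have hpt : ∀ q ∈ Ioo 0 T ×ˢ Ioo (0 : ℝ) 1,
      2 * ⟪Dv q (1, 0), J (Dv q (0, 1))⟫ + l * (2 * ⟪Dv q (1, 0), (T - q.1) • v q⟫)
        ≤ (1 + T * C) ^ 2 * (Real.exp (l * (T - q.1) ^ 2) * ‖u q‖ ^ 2) := by
    intro q hq
    set e := Real.exp (l / 2 * (T - q.1) ^ 2) with he
    have hepos : 0 < e := Real.exp_pos _
    have hr : 0 ≤ T - q.1 := sub_nonneg.2 hq.1.2.le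
    have hrT : T - q.1 ≤ T := sub_le_self _ hq.1.1.le
    have hsum : Dv q (1, 0) + (J (Dv q (0, 1)) + l • (T - q.1) • v q)
        = e • ((T - q.1) • (Du q (1, 0) + J (Du q (0, 1))) - u q) := by
      simp only [hDvs, hDvt, hv, hw, hw', map_smul, ← he]
      module
    have hn : ‖(T - q.1) • (Du q (1, 0) + J (Du q (0, 1))) - u q‖ ≤ (1 + T * C) * ‖u q‖ := by
      calc _ ≤ ‖(T - q.1) • (Du q (1, 0) + J (Du q (0, 1)))‖ + ‖u q‖ := norm_sub_le _ _
        _ ≤ T * (C * ‖u q‖) + ‖u q‖ := by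
          rw [norm_smul, Real.norm_of_nonneg hr]
          gcongr
          exact heq q (hUQ hq)
        _ = _ := by ring
    have hsq : ‖Dv q (1, 0) + (J (Dv q (0, 1)) + l • (T - q.1) • v q)‖ ^ 2
        ≤ (1 + T * C) ^ 2 * (Real.exp (l * (T - q.1) ^ 2) * ‖u q‖ ^ 2) := by
      rw [hsum, norm_smul, Real.norm_of_nonneg hepos.le, hexp, ← he]
      calc _ ≤ (e * ((1 + T * C) * ‖u q‖)) ^ 2 := by gcongr
        _ = _ := by ring
    rw [norm_add_sq_real, inner_add_right] at hsq
    have h1 := sq_nonneg ‖Dv q (1, 0)‖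
    have h2 := sq_nonneg ‖J (Dv q (0, 1)) + l • (T - q.1) • v q‖
    simp only [inner_smul_right] at hsq ⊢
    linarith
  have hmono := setIntegral_mono_on (hiAB.add hiAv) hiu hUm hpt
  simp only [Pi.add_apply] at hmono
  rw [integral_add hiAB hiAv, integral_const_mul l, hW, integral_const_mul 2,
    ← integral_const_mul l] at hmono
  have hfin : ∫ q in Ioo 0 T ×ˢ Ioo (0 : ℝ) 1,
      (l * (T - q.1) ^ 2 - (1 + T * C) ^ 2) * Real.exp (l * (T - q.1) ^ 2) * ‖u q‖ ^ 2
      = (∫ q in Ioo 0 T ×ˢ Ioo (0 : ℝ) 1, l * ‖v q‖ ^ 2)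
        - ∫ q in Ioo 0 T ×ˢ Ioo (0 : ℝ) 1,
          (1 + T * C) ^ 2 * (Real.exp (l * (T - q.1) ^ 2) * ‖u q‖ ^ 2) := by
    rw [← integral_sub hiv hiu]
    refine integral_congr_ae (ae_of_all _ fun q => ?_)
    simp only [hv, hw, norm_smul, mul_pow, Real.norm_eq_abs, sq_abs, hexp]
    ring
  rw [hfin]
  linarith

theorem eqOn_zero_of_norm_fderiv_add_le [FiniteDimensional ℝ E] {J : E →L[ℝ] E}
    (hJ : ∀ v w, ⟪J v, w⟫ = -⟪v, J w⟫) {Λ : Submodule ℝ E} (hΛ : ∀ v ∈ Λ, ∀ w ∈ Λ, ⟪v, J w⟫ = 0)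
    {T C : ℝ} {u : ℝ × ℝ → E} {Du : ℝ × ℝ → ℝ × ℝ →L[ℝ] E}
    (hd : ∀ q ∈ Icc 0 T ×ˢ Icc (0 : ℝ) 1,
      HasFDerivWithinAt u (Du q) (Icc 0 T ×ˢ Icc (0 : ℝ) 1) q)
    (h2s : IntegrableOn (fun q => ‖Du q (1, 0)‖ ^ 2) (Ioo 0 T ×ˢ Ioo (0 : ℝ) 1))
    (h2t : IntegrableOn (fun q => ‖Du q (0, 1)‖ ^ 2) (Ioo 0 T ×ˢ Ioo (0 : ℝ) 1))
    (hbc : ∀ s ∈ Icc 0 T, u (s, 0) ∈ Λ ∧ u (s, 1) ∈ Λ)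
    (h0 : ∀ t ∈ Icc (0 : ℝ) 1, u (0, t) = 0)
    (heq : ∀ q ∈ Icc 0 T ×ˢ Icc (0 : ℝ) 1, ‖Du q (1, 0) + J (Du q (0, 1))‖ ≤ C * ‖u q‖)
    {s t : ℝ} (hs : s ∈ Ico 0 T) (ht : t ∈ Icc (0 : ℝ) 1) : u (s, t) = 0 := by
  have hcont : ContinuousOn u (Icc 0 T ×ˢ Icc (0 : ℝ) 1) :=
    fun q hq => (hd q hq).continuousWithinAt
  have hT : 0 < T := hs.1.trans_lt hs.2
  obtain ⟨a, ha, hsa, hdT⟩ : ∃ a, 0 < a ∧ s ≤ T - 2 * a ∧ 0 < T - 2 * a :=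
    ⟨(T - s) / 4, by linarith [hs.2], by linarith [hs.2], by linarith [hs.1, hs.2]⟩
  set U := Ioo 0 T ×ˢ Ioo (0 : ℝ) 1 with hU
  set V := Ioo 0 (T - 2 * a) ×ˢ Ioo (0 : ℝ) 1 with hV
  have hUm : MeasurableSet U := measurableSet_Ioo_prod_Ioo _ _ _ _
  have hVm : MeasurableSet V := measurableSet_Ioo_prod_Ioo _ _ _ _
  have hUQ : U ⊆ Icc 0 T ×ˢ Icc (0 : ℝ) 1 := Ioo_prod_Ioo_subset_Icc_prod_Icc 0 T 0 1
  have hVU : V ⊆ U := prod_mono (Ioo_subset_Ioo_right (by linarith)) subset_rfl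
  have hQc : IsCompact (Icc 0 T ×ˢ Icc (0 : ℝ) 1) := isCompact_Icc.prod isCompact_Icc
  have hintu : IntegrableOn (fun q => ‖u q‖ ^ 2) U :=
    ((hcont.norm.pow 2).integrableOn_compact hQc).mono_set hUQ
  set K := (1 + T * C) ^ 2 with hK
  have hK0 : 0 ≤ K := sq_nonneg _
  have hbound : ∀ l : ℝ, K + 1 ≤ l * a ^ 2 →
      ∫ q in V, ‖u q‖ ^ 2 ≤ Real.exp (-(l * (3 * a ^ 2))) * (K * ∫ q in U, ‖u q‖ ^ 2) := by
    intro l hl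
    have hl0 : 0 ≤ l := le_of_mul_le_mul_right (by linarith) (pow_pos ha 2)
    have hcarl := carleman_inequality hJ hΛ hT.le hd h2s h2t hbc h0 heq l
    have hintw : IntegrableOn (fun q =>
        (l * (T - q.1) ^ 2 - K) * Real.exp (l * (T - q.1) ^ 2) * ‖u q‖ ^ 2) U := by
      have hc : ContinuousOn (fun q : ℝ × ℝ =>
          (l * (T - q.1) ^ 2 - K) * Real.exp (l * (T - q.1) ^ 2) * ‖u q‖ ^ 2)
          (Icc 0 T ×ˢ Icc (0 : ℝ) 1) := ContinuousOn.mul (by fun_prop) (hcont.norm.pow 2)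
      exact (hc.integrableOn_compact hQc).mono_set hUQ
    have hpt : ∀ q ∈ U, V.indicator (fun q => Real.exp (l * (2 * a) ^ 2) * ‖u q‖ ^ 2) q
        ≤ (l * (T - q.1) ^ 2 - K) * Real.exp (l * (T - q.1) ^ 2) * ‖u q‖ ^ 2
          + Real.exp (l * a ^ 2) * K * ‖u q‖ ^ 2 := by
      intro q hq
      have hr : 0 ≤ T - q.1 := sub_nonneg.2 hq.1.2.le
      have hrest : 0 ≤ Real.exp (l * a ^ 2) * K * ‖u q‖ ^ 2 := by positivity
      rcases le_or_gt (T - q.1) a with h | h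
      · have hqV : q ∉ V := fun hqV => by linarith [hqV.1.2]
        rw [indicator_of_notMem hqV, ← add_mul]
        have hle : Real.exp (l * (T - q.1) ^ 2) ≤ Real.exp (l * a ^ 2) := by gcongr
        have h1 : K * Real.exp (l * (T - q.1) ^ 2) ≤ K * Real.exp (l * a ^ 2) := by gcongr
        have h2 : 0 ≤ l * (T - q.1) ^ 2 * Real.exp (l * (T - q.1) ^ 2) := by positivity
        exact mul_nonneg (by linarith) (by positivity)
      · have h1 : 1 ≤ l * (T - q.1) ^ 2 - K := by
          have : l * a ^ 2 ≤ l * (T - q.1) ^ 2 := by gcongr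
          linarith
        have h2 : Real.exp (l * (T - q.1) ^ 2)
            ≤ (l * (T - q.1) ^ 2 - K) * Real.exp (l * (T - q.1) ^ 2) :=
          le_mul_of_one_le_left (Real.exp_pos _).le h1
        by_cases hqV : q ∈ V
        · rw [indicator_of_mem hqV]
          refine le_add_of_le_of_nonneg (mul_le_mul_of_nonneg_right (le_trans ?_ h2)
            (by positivity)) hrest
          have : 2 * a ≤ T - q.1 := by linarith [hqV.1.2]
          gcongr
        · rw [indicator_of_notMem hqV]
          exact add_nonneg (mul_nonneg ((Real.exp_pos _).le.trans h2) (by positivity)) hrest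
    have hintV : IntegrableOn (fun q => Real.exp (l * (2 * a) ^ 2) * ‖u q‖ ^ 2) V :=
      (hintu.mono_set hVU).const_mul _
    have hmono := setIntegral_mono_on (hintV.integrable_indicator hVm).integrableOn
      (hintw.add (hintu.const_mul (Real.exp (l * a ^ 2) * K))) hUm hpt
    simp only [Pi.add_apply] at hmono
    rw [integral_add hintw (hintu.const_mul _), setIntegral_indicator hVm,
      inter_eq_self_of_subset_right hVU, integral_const_mul, integral_const_mul] at hmono
    have hle : Real.exp (l * (2 * a) ^ 2) * ∫ q in V, ‖u q‖ ^ 2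
        ≤ Real.exp (l * (2 * a) ^ 2)
          * (Real.exp (-(l * (3 * a ^ 2))) * (K * ∫ q in U, ‖u q‖ ^ 2)) := by
      rw [← mul_assoc, ← Real.exp_add, ← mul_assoc]
      have : l * (2 * a) ^ 2 + -(l * (3 * a ^ 2)) = l * a ^ 2 := by ring
      rw [this]
      linarith
    exact le_of_mul_le_mul_left hle (Real.exp_pos _)
  have hlim : Tendsto (fun l : ℝ => Real.exp (-(l * (3 * a ^ 2))) * (K * ∫ q in U, ‖u q‖ ^ 2))
      atTop (𝓝 0) := by
    rw [← zero_mul (K * ∫ q in U, ‖u q‖ ^ 2)]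
    exact (Real.tendsto_exp_neg_atTop_nhds_zero.comp
      (tendsto_id.atTop_mul_const (by positivity))).mul_const _
  have hle0 : ∫ q in V, ‖u q‖ ^ 2 ≤ 0 := by
    refine ge_of_tendsto hlim ?_
    filter_upwards [(tendsto_id.atTop_mul_const (pow_pos ha 2)).eventually_ge_atTop (K + 1)]
      with l hl using hbound l hl
  have hae : u =ᵐ[volume.restrict V] fun _ => 0 := by
    have := (integral_eq_zero_iff_of_nonneg (fun q => by positivity) (hintu.mono_set hVU)).1
      (hle0.antisymm (integral_nonneg fun q => by positivity))
    filter_upwards [this] with q hq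
    simpa using hq
  have hEq : EqOn u (fun _ => 0) V :=
    Measure.eqOn_open_of_ae_eq hae (isOpen_Ioo_prod_Ioo _ _ _ _)
      (hcont.mono (hVU.trans hUQ)) continuousOn_const
  have hcl : closure V = Icc 0 (T - 2 * a) ×ˢ Icc (0 : ℝ) 1 := by
    rw [hV, closure_prod_eq, closure_Ioo hdT.ne, closure_Ioo zero_ne_one]
  have hsub : Icc 0 (T - 2 * a) ×ˢ Icc (0 : ℝ) 1 ⊆ Icc 0 T ×ˢ Icc (0 : ℝ) 1 :=
    prod_mono (Icc_subset_Icc_right (by linarith)) subset_rfl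
  exact hEq.of_subset_closure (hcont.mono hsub) continuousOn_const
    (Ioo_prod_Ioo_subset_Icc_prod_Icc _ _ _ _) hcl.ge ⟨⟨hs.1, hsa⟩, ht⟩

theorem Icc_prod_Icc_subset_Corner {ε : ℝ≥0∞} {T : ℝ} (hTε : ENNReal.ofReal T < ε) :
    Icc 0 T ×ˢ Icc (0 : ℝ) 1 ⊆ Corner ε := fun _ hq =>
  ⟨hq.1.1, (ENNReal.ofReal_le_ofReal hq.1.2).trans_lt hTε, hq.2⟩

theorem exists_gt_ofReal_lt {ε : ℝ≥0∞} {s : ℝ} (hs : 0 ≤ s) (hsε : ENNReal.ofReal s < ε) :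
    ∃ T, s < T ∧ ENNReal.ofReal T < ε := by
  obtain ⟨T, h1, h2⟩ := ENNReal.lt_iff_exists_nnreal_btwn.1 hsε
  refine ⟨T, ?_, by simpa using h2⟩
  rwa [← ENNReal.ofReal_coe_nnreal, ENNReal.ofReal_lt_ofReal_iff_of_nonneg hs] at h1

/-- Unique continuation in the `s`-direction for `∂ₛ + J∂ₜ + S`, with `J` skew-symmetric and `Λ`
isotropic. -/
theorem H1bcOn.eqOn_of_eq_at_zero [FiniteDimensional ℝ E] {J : E →L[ℝ] E}
    (hJ : ∀ v w, ⟪J v, w⟫ = -⟪v, J w⟫) {Λ : Submodule ℝ E} (hΛ : ∀ v ∈ Λ, ∀ w ∈ Λ, ⟪v, J w⟫ = 0)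
    {ε : ℝ≥0∞} {S : ℝ × ℝ → E →L[ℝ] E} (hS : ContinuousOn S (Corner ε))
    {ξ₁ ξ₂ : ℝ × ℝ → E} {Dξ₁ Dξ₂ : ℝ × ℝ → ℝ × ℝ →L[ℝ] E}
    (h₁ : H1bcOn Λ ε ξ₁ Dξ₁) (h₂ : H1bcOn Λ ε ξ₂ Dξ₂)
    (heq : ∀ q ∈ Corner ε, Dξ₁ q (1, 0) + J (Dξ₁ q (0, 1)) + S q (ξ₁ q)
      = Dξ₂ q (1, 0) + J (Dξ₂ q (0, 1)) + S q (ξ₂ q))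
    (h0 : ∀ t ∈ Icc (0 : ℝ) 1, ξ₁ (0, t) = ξ₂ (0, t)) : EqOn ξ₁ ξ₂ (Corner ε) := by
  rintro ⟨s, t⟩ ⟨hs, hsε, ht⟩
  obtain ⟨T, hsT, hTε⟩ := exists_gt_ofReal_lt hs hsε
  have hQ := Icc_prod_Icc_subset_Corner hTε
  have hUm : MeasurableSet (Ioo 0 T ×ˢ Ioo (0 : ℝ) 1) := measurableSet_Ioo_prod_Ioo _ _ _ _
  have hU := (Ioo_prod_Ioo_subset_Icc_prod_Icc 0 T 0 1).trans hQ
  have hd : ∀ q ∈ Icc 0 T ×ˢ Icc (0 : ℝ) 1, HasFDerivWithinAt (fun q => ξ₁ q - ξ₂ q)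
      (Dξ₁ q - Dξ₂ q) (Icc 0 T ×ˢ Icc (0 : ℝ) 1) q := fun q hq =>
    ((h₁.1 q (hQ hq)).sub (h₂.1 q (hQ hq))).mono hQ
  have hint : ∀ e, IntegrableOn (fun q => ‖Dξ₁ q e‖ ^ 2) (Corner ε) →
      IntegrableOn (fun q => ‖Dξ₂ q e‖ ^ 2) (Corner ε) →
      IntegrableOn (fun q => ‖(Dξ₁ q - Dξ₂ q) e‖ ^ 2) (Ioo 0 T ×ˢ Ioo (0 : ℝ) 1) := by
    intro e i₁ i₂
    have hD₁ := memLp_indicator_fderiv_apply (fun q hq => (h₁.1 q (hQ hq)).mono hQ)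
      (i₁.mono_set hU)
    have hD₂ := memLp_indicator_fderiv_apply (fun q hq => (h₂.1 q (hQ hq)).mono hQ)
      (i₂.mono_set hU)
    rw [memLp_indicator_iff_restrict hUm] at hD₁ hD₂
    have hD := hD₁.sub hD₂
    exact (memLp_two_iff_integrable_sq_norm hD.1).1 hD
  obtain ⟨C, hC⟩ := (isCompact_Icc.prod isCompact_Icc).exists_bound_of_continuousOn (hS.mono hQ)
  refine sub_eq_zero.1 (eqOn_zero_of_norm_fderiv_add_le (C := C) (Λ := Λ) hJ hΛ hd
    (hint _ h₁.2.2.1 h₂.2.2.1) (hint _ h₁.2.2.2.1 h₂.2.2.2.1) (fun r hr => ?_)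
    (fun r hr => sub_eq_zero.2 (h0 r hr)) (fun q hq => ?_) ⟨hs, hsT⟩ ht)
  · have hrε := (ENNReal.ofReal_le_ofReal hr.2).trans_lt hTε
    have hb₁ := h₁.2.2.2.2 r hr.1 hrε
    have hb₂ := h₂.2.2.2.2 r hr.1 hrε
    exact ⟨Λ.sub_mem hb₁.1 hb₂.1, Λ.sub_mem hb₁.2 hb₂.2⟩
  · have h : (Dξ₁ q - Dξ₂ q) (1, 0) + J ((Dξ₁ q - Dξ₂ q) (0, 1)) = -S q (ξ₁ q - ξ₂ q) := by
      have := heq q (hQ hq)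
      simp only [_root_.sub_apply, map_sub]
      rw [← sub_eq_zero] at this ⊢
      rw [← this]
      abel
    rw [h, norm_neg]
    exact (S q).le_of_opNorm_le (hC q hq) _

theorem inner_apply_left_eq_neg_of_isometry {J : E →L[ℝ] E} (hJiso : ∀ v, ‖J v‖ = ‖v‖)
    (hJ2 : ∀ v, J (J v) = -v) (v w : E) : ⟪J v, w⟫ = -⟪v, J w⟫ := by
  have h := (LinearMap.norm_map_iff_inner_map_map J).1 hJiso v (J w)
  rw [hJ2, inner_neg_right] at h
  rw [← h, neg_neg]

end UniqueContinuation

/-- **unique continuation.**  Let `0 < ε ≤ ∞` and let `D` be the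
time-dependent operator `Dξ = ∂_sξ + J₀∂_tξ + S(s,t)ξ = ∂_sξ + Aξ + Rξ` on
`[0,ε)×[0,1]`; for `ε = ∞` assume (H1).  Then for `i = 1, 2` the map
`ξ ↦ (Dξ, ξ(0,·))` on `H^i_bc([0,ε)×[0,1])` is injective, and the same holds for the
formal adjoint `D*ξ = −∂_sξ + J₀∂_tξ + S(s,t)^Tξ`. -/
theorem stmt_15
    {E : Type*} [NormedAddCommGroup E] [InnerProductSpace ℝ E] [FiniteDimensional ℝ E]
    (n : ℕ) (hdim : Module.finrank ℝ E = 2 * n)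
    (J : E →L[ℝ] E) (hJiso : ∀ v : E, ‖J v‖ = ‖v‖) (hJ2 : ∀ v : E, J (J v) = -v)
    (Λ : Submodule ℝ E) (hΛdim : Module.finrank ℝ Λ = n)
    (hJΛ : ∀ v : E, v ∈ Λ ↔ J v ∈ Λᗮ)
    (S1 : ℝ → E →L[ℝ] E) (hS1 : ContDiff ℝ (⊤ : ℕ∞) S1)
    (hS1sym : ∀ (t : ℝ) (v w : E), ⟪S1 t v, w⟫ = ⟪v, S1 t w⟫)
    {ι : Type*} (x : ι → ℝ → E) (μ : ι → ℝ)
    (hEig : EigenData J Λ S1 x μ)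
    (ε : ℝ≥0∞) (hε : 0 < ε)
    -- the perturbation `R ∈ W^{1,2}`, so that `S(s,t) = S₁(t) + R(s,t)`
    (R : ℝ × ℝ → E →L[ℝ] E) (DR : ℝ × ℝ → ℝ × ℝ →L[ℝ] E →L[ℝ] E)
    (hR : ∀ q ∈ Corner ε, HasFDerivWithinAt R (DR q) (Corner ε) q)
    (hR2 : IntegrableOn (fun q => ‖R q‖ ^ 2) (Corner ε) volume)
    (hDR2s : IntegrableOn (fun q => ‖DR q (1, 0)‖ ^ 2) (Corner ε) volume)
    (hDR2t : IntegrableOn (fun q => ‖DR q (0, 1)‖ ^ 2) (Corner ε) volume)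
    -- hypothesis (H1) in the case `ε = ∞`
    (hH1 : ε = ⊤ →
      ∃ Sinf : ℝ → E →L[ℝ] E, ContDiff ℝ (⊤ : ℕ∞) Sinf ∧
        (∀ (t : ℝ) (v w : E), ⟪Sinf t v, w⟫ = ⟪v, Sinf t w⟫) ∧
        (∃ (ι' : Type) (xinf : ι' → ℝ → E) (μinf : ι' → ℝ),
          EigenData J Λ Sinf xinf μinf) ∧
        ∀ δ : ℝ, 0 < δ → ∃ s₀ : ℝ, ∀ q ∈ Corner ε, s₀ ≤ q.1 →
          ‖S1 q.2 + R q - Sinf q.2‖ ≤ δ ∧ ‖DR q (1, 0)‖ ≤ δ ∧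
          ‖deriv S1 q.2 + DR q (0, 1) - deriv Sinf q.2‖ ≤ δ) :
    -- `ξ ↦ (Dξ, ξ(0,·))` is injective on `H¹_bc` …
    ((∀ (ξ₁ : ℝ × ℝ → E) (Dξ₁ : ℝ × ℝ → ℝ × ℝ →L[ℝ] E)
        (ξ₂ : ℝ × ℝ → E) (Dξ₂ : ℝ × ℝ → ℝ × ℝ →L[ℝ] E),
        H1bcOn Λ ε ξ₁ Dξ₁ → H1bcOn Λ ε ξ₂ Dξ₂ →
        (∀ q ∈ Corner ε,
          Dξ₁ q (1, 0) + J (Dξ₁ q (0, 1)) + (S1 q.2 + R q) (ξ₁ q)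
            = Dξ₂ q (1, 0) + J (Dξ₂ q (0, 1)) + (S1 q.2 + R q) (ξ₂ q)) →
        (∀ t ∈ Icc (0:ℝ) 1, ξ₁ (0, t) = ξ₂ (0, t)) →
        ∀ q ∈ Corner ε, ξ₁ q = ξ₂ q)
      ∧
      -- … and on `H²_bc`
      (∀ (ξ₁ : ℝ × ℝ → E) (Dξ₁ : ℝ × ℝ → ℝ × ℝ →L[ℝ] E)
        (D2ξ₁ : ℝ × ℝ → ℝ × ℝ →L[ℝ] ℝ × ℝ →L[ℝ] E)
        (ξ₂ : ℝ × ℝ → E) (Dξ₂ : ℝ × ℝ → ℝ × ℝ →L[ℝ] E)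
        (D2ξ₂ : ℝ × ℝ → ℝ × ℝ →L[ℝ] ℝ × ℝ →L[ℝ] E),
        H2bcOn Λ J S1 ε ξ₁ Dξ₁ D2ξ₁ → H2bcOn Λ J S1 ε ξ₂ Dξ₂ D2ξ₂ →
        (∀ q ∈ Corner ε,
          Dξ₁ q (1, 0) + J (Dξ₁ q (0, 1)) + (S1 q.2 + R q) (ξ₁ q)
            = Dξ₂ q (1, 0) + J (Dξ₂ q (0, 1)) + (S1 q.2 + R q) (ξ₂ q)) →
        (∀ t ∈ Icc (0:ℝ) 1, ξ₁ (0, t) = ξ₂ (0, t)) →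
        ∀ q ∈ Corner ε, ξ₁ q = ξ₂ q))
    ∧
    -- the same for the formal adjoint `D*ξ = −∂_sξ + J₀∂_tξ + S(s,t)^Tξ`: on `H¹_bc` …
    ((∀ (ξ₁ : ℝ × ℝ → E) (Dξ₁ : ℝ × ℝ → ℝ × ℝ →L[ℝ] E)
        (ξ₂ : ℝ × ℝ → E) (Dξ₂ : ℝ × ℝ → ℝ × ℝ →L[ℝ] E),
        H1bcOn Λ ε ξ₁ Dξ₁ → H1bcOn Λ ε ξ₂ Dξ₂ →
        (∀ q ∈ Corner ε,
          -Dξ₁ q (1, 0) + J (Dξ₁ q (0, 1))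
              + ContinuousLinearMap.adjoint (S1 q.2 + R q) (ξ₁ q)
            = -Dξ₂ q (1, 0) + J (Dξ₂ q (0, 1))
              + ContinuousLinearMap.adjoint (S1 q.2 + R q) (ξ₂ q)) →
        (∀ t ∈ Icc (0:ℝ) 1, ξ₁ (0, t) = ξ₂ (0, t)) →
        ∀ q ∈ Corner ε, ξ₁ q = ξ₂ q)
      ∧
      -- … and on `H²_bc`
      (∀ (ξ₁ : ℝ × ℝ → E) (Dξ₁ : ℝ × ℝ → ℝ × ℝ →L[ℝ] E)
        (D2ξ₁ : ℝ × ℝ → ℝ × ℝ →L[ℝ] ℝ × ℝ →L[ℝ] E)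
        (ξ₂ : ℝ × ℝ → E) (Dξ₂ : ℝ × ℝ → ℝ × ℝ →L[ℝ] E)
        (D2ξ₂ : ℝ × ℝ → ℝ × ℝ →L[ℝ] ℝ × ℝ →L[ℝ] E),
        H2bcOn Λ J S1 ε ξ₁ Dξ₁ D2ξ₁ → H2bcOn Λ J S1 ε ξ₂ Dξ₂ D2ξ₂ →
        (∀ q ∈ Corner ε,
          -Dξ₁ q (1, 0) + J (Dξ₁ q (0, 1))
              + ContinuousLinearMap.adjoint (S1 q.2 + R q) (ξ₁ q)
            = -Dξ₂ q (1, 0) + J (Dξ₂ q (0, 1))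
              + ContinuousLinearMap.adjoint (S1 q.2 + R q) (ξ₂ q)) →
        (∀ t ∈ Icc (0:ℝ) 1, ξ₁ (0, t) = ξ₂ (0, t)) →
        ∀ q ∈ Corner ε, ξ₁ q = ξ₂ q)) := by
  have hJ := inner_apply_left_eq_neg_of_isometry hJiso hJ2
  have hΛ : ∀ v ∈ Λ, ∀ w ∈ Λ, ⟪v, J w⟫ = 0 := fun v hv w hw =>
    (Submodule.mem_orthogonal _ _).1 ((hJΛ w).1 hw) v hv
  have hS : ContinuousOn (fun q : ℝ × ℝ => S1 q.2 + R q) (Corner ε) :=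
    (hS1.continuous.comp continuous_snd).continuousOn.add
      fun q hq => (hR q hq).continuousWithinAt
  have hS' : ContinuousOn (fun q : ℝ × ℝ => -ContinuousLinearMap.adjoint (S1 q.2 + R q))
      (Corner ε) :=
    ((ContinuousLinearMap.adjoint (𝕜 := ℝ) (E := E) (F := E)).continuous.comp_continuousOn hS).neg
  have hD : ∀ (ξ₁ : ℝ × ℝ → E) (Dξ₁ : ℝ × ℝ → ℝ × ℝ →L[ℝ] E)
      (ξ₂ : ℝ × ℝ → E) (Dξ₂ : ℝ × ℝ → ℝ × ℝ →L[ℝ] E),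
      H1bcOn Λ ε ξ₁ Dξ₁ → H1bcOn Λ ε ξ₂ Dξ₂ →
      (∀ q ∈ Corner ε,
        Dξ₁ q (1, 0) + J (Dξ₁ q (0, 1)) + (S1 q.2 + R q) (ξ₁ q)
          = Dξ₂ q (1, 0) + J (Dξ₂ q (0, 1)) + (S1 q.2 + R q) (ξ₂ q)) →
      (∀ t ∈ Icc (0:ℝ) 1, ξ₁ (0, t) = ξ₂ (0, t)) → ∀ q ∈ Corner ε, ξ₁ q = ξ₂ q :=
    fun _ _ _ _ h₁ h₂ heq h0 => h₁.eqOn_of_eq_at_zero hJ hΛ hS h₂ heq h0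
  have hD' : ∀ (ξ₁ : ℝ × ℝ → E) (Dξ₁ : ℝ × ℝ → ℝ × ℝ →L[ℝ] E)
      (ξ₂ : ℝ × ℝ → E) (Dξ₂ : ℝ × ℝ → ℝ × ℝ →L[ℝ] E),
      H1bcOn Λ ε ξ₁ Dξ₁ → H1bcOn Λ ε ξ₂ Dξ₂ →
      (∀ q ∈ Corner ε,
        -Dξ₁ q (1, 0) + J (Dξ₁ q (0, 1)) + ContinuousLinearMap.adjoint (S1 q.2 + R q) (ξ₁ q)
          = -Dξ₂ q (1, 0) + J (Dξ₂ q (0, 1))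
            + ContinuousLinearMap.adjoint (S1 q.2 + R q) (ξ₂ q)) →
      (∀ t ∈ Icc (0:ℝ) 1, ξ₁ (0, t) = ξ₂ (0, t)) → ∀ q ∈ Corner ε, ξ₁ q = ξ₂ q := by
    intro ξ₁ Dξ₁ ξ₂ Dξ₂ h₁ h₂ heq h0
    refine h₁.eqOn_of_eq_at_zero (J := -J) (fun v w => by simp [hJ])
      (fun v hv w hw => by simp [hΛ v hv w hw]) hS' h₂ (fun q hq => ?_) h0
    have h := congrArg Neg.neg (heq q hq)
    simpa only [neg_add, neg_neg, _root_.neg_apply] using h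
  exact ⟨⟨hD, fun ξ₁ Dξ₁ _ ξ₂ Dξ₂ _ h₁ h₂ => hD ξ₁ Dξ₁ ξ₂ Dξ₂ h₁.1 h₂.1⟩,
    hD', fun ξ₁ Dξ₁ _ ξ₂ Dξ₂ _ h₁ h₂ => hD' ξ₁ Dξ₁ ξ₂ Dξ₂ h₁.1 h₂.1⟩
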